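/- Assume (A,B) is controllable. Then f attains a global minimum on S at a unique point K_*; moreover K_* is the unique critical point of f in S (i.e., the unique K ∈ S with ∇f(K) = 0) and it satisfies K_* = (R + Bᵀ X(K_*) B)^{−1} Bᵀ X(K_*) A. -/

import Mathlib

open Matrix

/-- `M` is Schur stable: spectral radius `ρ(M) < 1`. -/
def IsSchur {k : ℕ} (M : Matrix (Fin k) (Fin k) ℝ) : Prop :=
  ∀ μ ∈ spectrum ℂ (M.map (Complex.ofReal ·)), ‖μ‖ < 1

/-- The pair `(A, B)` is controllable (Kalman rank condition). -/
def Controllable {n m : ℕ} (A : Matrix (Fin n) (Fin n) ℝ) (B : Matrix (Fin n) (Fin m) ℝ) : Prop :=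
  (Matrix.of fun (i : Fin n) (p : Fin n × Fin m) => (A ^ (p.1 : ℕ) * B) i p.2).rank = n

open Filter Topology
open scoped NNReal ENNReal

section Gelfand

theorem tendsto_pow_zero_of_spectralRadius_lt_one {𝒜 : Type*} [NormedRing 𝒜] [NormedAlgebra ℂ 𝒜]
    [CompleteSpace 𝒜] {a : 𝒜} (ha : spectralRadius ℂ a < 1) :
    Tendsto (fun k : ℕ => a ^ k) atTop (𝓝 0) := by
  obtain ⟨r, har, hr1⟩ := ENNReal.lt_iff_exists_nnreal_btwn.mp ha
  have hr : r < 1 := by exact_mod_cast hr1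
  have hev :=
    (spectrum.pow_nnnorm_pow_one_div_tendsto_nhds_spectralRadius a).eventually_lt_const har
  refine squeeze_zero_norm' (a := fun k : ℕ => (r : ℝ) ^ k) ?_
    (tendsto_pow_atTop_nhds_zero_of_lt_one r.2 (by exact_mod_cast hr))
  filter_upwards [hev, eventually_gt_atTop 0] with k hk hk0
  have h := ENNReal.rpow_le_rpow hk.le (Nat.cast_nonneg (α := ℝ) k)
  rw [← ENNReal.rpow_mul, one_div_mul_cancel (by positivity), ENNReal.rpow_one,
    ENNReal.rpow_natCast] at h
  exact_mod_cast h

attribute [local instance] Matrix.linftyOpNormedRing Matrix.linftyOpNormedAlgebra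

theorem IsSchur.tendsto_pow {k : ℕ} {M : Matrix (Fin k) (Fin k) ℝ} (hM : IsSchur M) :
    Tendsto (fun j : ℕ => M ^ j) atTop (𝓝 0) := by
  rcases isEmpty_or_nonempty (Fin k) with hk | hk
  · exact tendsto_const_nhds.congr fun j => Subsingleton.elim _ _
  have h1 : spectralRadius ℂ (M.map (Complex.ofReal ·)) < ((1 : ℝ≥0) : ℝ≥0∞) :=
    spectrum.spectralRadius_lt_of_forall_lt _ fun z hz => hM z hz
  have h2 := tendsto_pow_zero_of_spectralRadius_lt_one h1
  have h3 : Tendsto (fun j : ℕ => ((M.map (Complex.ofReal ·)) ^ j).map Complex.re) atTop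
      (𝓝 ((0 : Matrix (Fin k) (Fin k) ℂ).map Complex.re)) :=
    ((continuous_id.matrix_map Complex.continuous_re).tendsto 0).comp h2
  have h4 : ∀ j : ℕ, ((M.map (Complex.ofReal ·)) ^ j).map Complex.re = M ^ j := fun j => by
    have : (M.map (Complex.ofReal ·)) ^ j = (M ^ j).map (Complex.ofReal ·) :=
      (map_pow (Complex.ofRealHom.mapMatrix) M j).symm
    rw [this]
    ext; simp
  simpa [h4] using h3

end Gelfand

/-- A strict discrete Lyapunov inequality certifies Schur stability. -/
theorem IsSchur.of_lyapunov {k : ℕ} {M P : Matrix (Fin k) (Fin k) ℝ} (hP : P.PosDef)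
    (hD : (P - Mᵀ * P * M).PosDef) : IsSchur M := by
  intro μ hμ
  rw [← Matrix.spectrum_toLin', ← Module.End.hasEigenvalue_iff_mem_spectrum] at hμ
  obtain ⟨v, hv⟩ := hμ.exists_hasEigenvector
  have hMv : (M.map (Complex.ofReal ·)) *ᵥ v = μ • v := by simpa using hv.apply_eq_smul
  set a : Fin k → ℝ := fun i => (v i).re
  set b : Fin k → ℝ := fun i => (v i).im
  have hMa : M *ᵥ a = μ.re • a - μ.im • b := by
    ext i
    have := congrArg Complex.re (congrFun hMv i)
    simpa [Matrix.mulVec, dotProduct, Complex.re_sum] using this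
  have hMb : M *ᵥ b = μ.im • a + μ.re • b := by
    ext i
    have := congrArg Complex.im (congrFun hMv i)
    simpa [Matrix.mulVec, dotProduct, Complex.im_sum, add_comm] using this
  have hform : ∀ x : Fin k → ℝ, x ⬝ᵥ (P - Mᵀ * P * M) *ᵥ x =
      x ⬝ᵥ P *ᵥ x - (M *ᵥ x) ⬝ᵥ P *ᵥ (M *ᵥ x) := fun x => by
    rw [sub_mulVec, dotProduct_sub, ← mulVec_mulVec, ← mulVec_mulVec, dotProduct_mulVec x Mᵀ,
      vecMul_transpose]
  have hsum : a ⬝ᵥ (P - Mᵀ * P * M) *ᵥ a + b ⬝ᵥ (P - Mᵀ * P * M) *ᵥ b =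
      (1 - ‖μ‖ ^ 2) * (a ⬝ᵥ P *ᵥ a + b ⬝ᵥ P *ᵥ b) := by
    rw [hform, hform, hMa, hMb, ← Complex.normSq_eq_norm_sq, Complex.normSq_apply]
    simp only [mulVec_add, mulVec_sub, mulVec_smul, add_dotProduct, sub_dotProduct, dotProduct_add,
      dotProduct_sub, smul_dotProduct, dotProduct_smul, smul_eq_mul]
    ring
  have hab : a ≠ 0 ∨ b ≠ 0 := by
    by_contra! h
    refine hv.2 (funext fun i => Complex.ext ?_ ?_)
    · exact congrFun h.1 i
    · exact congrFun h.2 i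
  have key : ∀ S : Matrix (Fin k) (Fin k) ℝ, S.PosDef → 0 < a ⬝ᵥ S *ᵥ a + b ⬝ᵥ S *ᵥ b := by
    intro S hS
    have ha0 : 0 ≤ a ⬝ᵥ S *ᵥ a := by simpa using hS.posSemidef.dotProduct_mulVec_nonneg a
    have hb0 : 0 ≤ b ⬝ᵥ S *ᵥ b := by simpa using hS.posSemidef.dotProduct_mulVec_nonneg b
    rcases hab with h | h
    · have : 0 < a ⬝ᵥ S *ᵥ a := by simpa using hS.dotProduct_mulVec_pos h
      linarith
    · have : 0 < b ⬝ᵥ S *ᵥ b := by simpa using hS.dotProduct_mulVec_pos h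
      linarith
  have h1 := key _ hD
  rw [hsum] at h1
  have h2 := pos_of_mul_pos_left h1 (key P hP).le
  nlinarith [norm_nonneg μ]

theorem Matrix.PosSemidef.of_tendsto {ι : Type*} [Fintype ι] {Z : ℕ → Matrix ι ι ℝ}
    {W : Matrix ι ι ℝ} (hZ : ∀ j, (Z j).PosSemidef) (h : Tendsto Z atTop (𝓝 W)) :
    W.PosSemidef := by
  refine .of_dotProduct_mulVec_nonneg ?_ fun x => ?_
  · refine tendsto_nhds_unique (((continuous_id.matrix_conjTranspose).tendsto W).comp h) ?_
    exact h.congr fun j => (hZ j).1.symm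
  · have hc : Continuous fun V : Matrix ι ι ℝ => star x ⬝ᵥ V *ᵥ x :=
      continuous_const.dotProduct (continuous_id.matrix_mulVec continuous_const)
    exact ge_of_tendsto' ((hc.tendsto W).comp h) fun j => (hZ j).dotProduct_mulVec_nonneg x

theorem Matrix.PosSemidef.transpose_mul_mul {ι κ : Type*} [Fintype ι] [Fintype κ]
    {Z : Matrix ι ι ℝ} (hZ : Z.PosSemidef) (C : Matrix ι κ ℝ) : (Cᵀ * Z * C).PosSemidef := by
  simpa using hZ.conjTranspose_mul_mul_same C

theorem IsSchur.transpose {k : ℕ} {M : Matrix (Fin k) (Fin k) ℝ} (hM : IsSchur M) :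
    IsSchur Mᵀ := by
  intro μ hμ
  refine hM μ ?_
  rw [spectrum.mem_iff] at hμ ⊢
  contrapose! hμ
  have h : algebraMap ℂ (Matrix (Fin k) (Fin k) ℂ) μ - Mᵀ.map (Complex.ofReal ·) =
      (algebraMap ℂ (Matrix (Fin k) (Fin k) ℂ) μ - M.map (Complex.ofReal ·))ᵀ := by
    simp [Matrix.algebraMap_eq_diagonal, Matrix.transpose_map]
  rw [h, Matrix.isUnit_transpose]
  exact hμ

theorem IsSchur.posSemidef_of_lyapunov {k : ℕ} {M Z W : Matrix (Fin k) (Fin k) ℝ} (hM : IsSchur M)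
    (hW : W.PosSemidef) (h : Mᵀ * Z * M + W = Z) : Z.PosSemidef := by
  have hstep : ∀ j : ℕ, (Z - (M ^ j)ᵀ * Z * M ^ j).PosSemidef := by
    intro j
    induction j with
    | zero => simpa using PosSemidef.zero
    | succ j ih =>
      have e : Z - (M ^ (j + 1))ᵀ * Z * M ^ (j + 1) =
          W + Mᵀ * (Z - (M ^ j)ᵀ * Z * M ^ j) * M := by
        rw [pow_succ, transpose_mul]
        nth_rw 1 [← h]
        noncomm_ring
      rw [e]
      exact hW.add (ih.transpose_mul_mul M)
  refine PosSemidef.of_tendsto hstep ?_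
  have hc : Continuous fun V : Matrix (Fin k) (Fin k) ℝ => Z - Vᵀ * Z * V := by fun_prop
  simpa [Function.comp_def] using (hc.tendsto 0).comp hM.tendsto_pow

theorem Matrix.PosSemidef.eq_of_sub_sub {ι : Type*} [Fintype ι] {Z W : Matrix ι ι ℝ}
    (h1 : (Z - W).PosSemidef) (h2 : (W - Z).PosSemidef) : Z = W := by
  refine sub_eq_zero.mp (h1.trace_eq_zero_iff.mp (le_antisymm ?_ h1.trace_nonneg))
  rw [← neg_sub W Z, trace_neg]
  exact neg_nonpos.mpr h2.trace_nonneg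

theorem IsSchur.lyapunov_unique {k : ℕ} {M Z Z' W : Matrix (Fin k) (Fin k) ℝ} (hM : IsSchur M)
    (h : Mᵀ * Z * M + W = Z) (h' : Mᵀ * Z' * M + W = Z') : Z = Z' := by
  refine Matrix.PosSemidef.eq_of_sub_sub (hM.posSemidef_of_lyapunov .zero ?_)
    (hM.posSemidef_of_lyapunov .zero ?_)
  · nth_rw 2 [← h, ← h']
    noncomm_ring
  · nth_rw 2 [← h, ← h']
    noncomm_ring

open scoped MatrixOrder in
theorem Matrix.PosDef.exists_eq_mul_transpose {ι : Type*} [Fintype ι] [DecidableEq ι]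
    {S : Matrix ι ι ℝ} (hS : S.PosDef) : ∃ C : Matrix ι ι ℝ, IsUnit C ∧ S = C * Cᵀ := by
  have hs : (CFC.sqrt S)ᵀ = CFC.sqrt S := by
    have := (nonneg_iff_posSemidef.mp (CFC.sqrt_nonneg S)).1
    simpa using this.eq
  have he : CFC.sqrt S * CFC.sqrt S = S :=
    CFC.sqrt_mul_sqrt_self S (nonneg_iff_posSemidef.mpr hS.posSemidef)
  refine ⟨CFC.sqrt S, ?_, by rw [hs, he]⟩
  have := hS.isUnit
  rw [← he] at this
  exact isUnit_of_mul_isUnit_left this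

theorem Matrix.PosSemidef.trace_mul_nonneg {ι : Type*} [Fintype ι] [DecidableEq ι]
    {Z S : Matrix ι ι ℝ} (hZ : Z.PosSemidef) (hS : S.PosDef) : 0 ≤ (Z * S).trace := by
  obtain ⟨C, -, rfl⟩ := hS.exists_eq_mul_transpose
  rw [← Matrix.mul_assoc, trace_mul_comm, ← Matrix.mul_assoc]
  exact (hZ.transpose_mul_mul C).trace_nonneg

theorem Matrix.PosSemidef.eq_zero_of_trace_mul_eq_zero {ι : Type*} [Fintype ι] [DecidableEq ι]
    {Z S : Matrix ι ι ℝ} (hZ : Z.PosSemidef) (hS : S.PosDef) (h : (Z * S).trace = 0) : Z = 0 := by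
  obtain ⟨C, hC, rfl⟩ := hS.exists_eq_mul_transpose
  rw [← Matrix.mul_assoc, trace_mul_comm, ← Matrix.mul_assoc,
    (hZ.transpose_mul_mul C).trace_eq_zero_iff] at h
  have hCt : IsUnit Cᵀ := (Matrix.isUnit_transpose C).mpr hC
  exact hCt.mul_right_eq_zero.mp (hC.mul_left_eq_zero.mp h)

section Riccati

variable {n m : ℕ}

/-- Right-hand side of the Lyapunov equation for the cost-to-go under the gain `K`. -/
def lyapunovStep (A : Matrix (Fin n) (Fin n) ℝ) (B : Matrix (Fin n) (Fin m) ℝ)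
    (Q : Matrix (Fin n) (Fin n) ℝ) (R : Matrix (Fin m) (Fin m) ℝ)
    (K : Matrix (Fin m) (Fin n) ℝ) (P : Matrix (Fin n) (Fin n) ℝ) : Matrix (Fin n) (Fin n) ℝ :=
  (A - B * K)ᵀ * P * (A - B * K) + Kᵀ * R * K + Q

/-- The gain minimizing `lyapunovStep` for a given cost-to-go matrix `P`. -/
noncomputable def riccatiGain (A : Matrix (Fin n) (Fin n) ℝ) (B : Matrix (Fin n) (Fin m) ℝ)
    (R : Matrix (Fin m) (Fin m) ℝ) (P : Matrix (Fin n) (Fin n) ℝ) : Matrix (Fin m) (Fin n) ℝ :=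
  (R + Bᵀ * P * B)⁻¹ * (Bᵀ * P * A)

/-- The Riccati operator of the discrete-time LQR problem. -/
noncomputable def riccatiStep (A : Matrix (Fin n) (Fin n) ℝ) (B : Matrix (Fin n) (Fin m) ℝ)
    (Q : Matrix (Fin n) (Fin n) ℝ) (R : Matrix (Fin m) (Fin m) ℝ)
    (P : Matrix (Fin n) (Fin n) ℝ) : Matrix (Fin n) (Fin n) ℝ :=
  lyapunovStep A B Q R (riccatiGain A B R P) P

variable {A : Matrix (Fin n) (Fin n) ℝ} {B : Matrix (Fin n) (Fin m) ℝ}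
  {Q : Matrix (Fin n) (Fin n) ℝ} {R : Matrix (Fin m) (Fin m) ℝ}

theorem Matrix.PosDef.add_transpose_mul_mul (hR : R.PosDef) {P : Matrix (Fin n) (Fin n) ℝ}
    (hP : P.PosSemidef) (B : Matrix (Fin n) (Fin m) ℝ) : (R + Bᵀ * P * B).PosDef :=
  hR.add_posSemidef (hP.transpose_mul_mul B)

theorem mul_riccatiGain (hR : R.PosDef) {P : Matrix (Fin n) (Fin n) ℝ} (hP : P.PosSemidef) :
    (R + Bᵀ * P * B) * riccatiGain A B R P = Bᵀ * P * A := by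
  rw [riccatiGain, ← Matrix.mul_assoc, Matrix.mul_nonsing_inv, Matrix.one_mul]
  exact (Matrix.isUnit_iff_isUnit_det _).mp (hR.add_transpose_mul_mul hP B).isUnit

/-- Completing the square in the gain. -/
theorem lyapunovStep_sub_riccatiStep (hR : R.PosDef) {P : Matrix (Fin n) (Fin n) ℝ}
    (hP : P.PosSemidef) (K : Matrix (Fin m) (Fin n) ℝ) :
    lyapunovStep A B Q R K P - riccatiStep A B Q R P =
      (K - riccatiGain A B R P)ᵀ * (R + Bᵀ * P * B) * (K - riccatiGain A B R P) := by
  have hL := mul_riccatiGain (A := A) (B := B) hR hP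
  unfold riccatiStep
  generalize riccatiGain A B R P = L at hL ⊢
  have hPt : Pᵀ = P := by simpa using hP.1.eq
  have hRt : Rᵀ = R := by simpa using hR.1.eq
  have hLt : Lᵀ * (R + Bᵀ * P * B) = Aᵀ * P * B := by
    have := congrArg Matrix.transpose hL
    simpa [Matrix.transpose_mul, Matrix.transpose_add, hPt, hRt, Matrix.mul_assoc] using this
  have hexp : ∀ V : Matrix (Fin m) (Fin n) ℝ, lyapunovStep A B Q R V P =
      Aᵀ * P * A - Vᵀ * (Bᵀ * P * A) - (Aᵀ * P * B) * V + Vᵀ * (R + Bᵀ * P * B) * V + Q := by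
    intro V
    simp only [lyapunovStep, Matrix.transpose_sub, Matrix.transpose_mul, Matrix.sub_mul,
      Matrix.mul_sub, Matrix.add_mul, Matrix.mul_add, Matrix.mul_assoc]
    abel
  rw [hexp, hexp, ← hLt, ← hL]
  simp only [Matrix.transpose_sub, Matrix.sub_mul, Matrix.mul_sub, Matrix.mul_assoc]
  abel

theorem lyapunovStep_sub (K : Matrix (Fin m) (Fin n) ℝ) (P P' : Matrix (Fin n) (Fin n) ℝ) :
    lyapunovStep A B Q R K P - lyapunovStep A B Q R K P' =
      (A - B * K)ᵀ * (P - P') * (A - B * K) := by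
  simp only [lyapunovStep, Matrix.mul_sub (A - B * K)ᵀ, Matrix.sub_mul _ _ (A - B * K)]
  abel

theorem posSemidef_lyapunovStep_sub_riccatiStep (hR : R.PosDef) {P P' : Matrix (Fin n) (Fin n) ℝ}
    (hP : P.PosSemidef) (hPP' : (P' - P).PosSemidef) (K : Matrix (Fin m) (Fin n) ℝ) :
    (lyapunovStep A B Q R K P' - riccatiStep A B Q R P).PosSemidef := by
  rw [← sub_add_sub_cancel _ (lyapunovStep A B Q R K P), lyapunovStep_sub,
    lyapunovStep_sub_riccatiStep hR hP]
  exact (hPP'.transpose_mul_mul _).add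
    ((hR.add_transpose_mul_mul hP B).posSemidef.transpose_mul_mul _)

theorem posSemidef_lyapunovStep (hQ : Q.PosSemidef) (hR : R.PosSemidef)
    {P : Matrix (Fin n) (Fin n) ℝ} (hP : P.PosSemidef) (K : Matrix (Fin m) (Fin n) ℝ) :
    (lyapunovStep A B Q R K P).PosSemidef :=
  ((hP.transpose_mul_mul _).add (hR.transpose_mul_mul _)).add hQ

theorem posSemidef_iterate_riccatiStep (hQ : Q.PosSemidef) (hR : R.PosSemidef) (j : ℕ) :
    ((riccatiStep A B Q R)^[j] 0).PosSemidef := by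
  induction j with
  | zero => exact .zero
  | succ j ih =>
    rw [Function.iterate_succ_apply']
    exact posSemidef_lyapunovStep hQ hR ih _

theorem posSemidef_iterate_riccatiStep_succ_sub (hQ : Q.PosSemidef) (hR : R.PosDef) (j : ℕ) :
    ((riccatiStep A B Q R)^[j + 1] 0 - (riccatiStep A B Q R)^[j] 0).PosSemidef := by
  induction j with
  | zero => simpa using posSemidef_iterate_riccatiStep (A := A) (B := B) hQ hR.posSemidef 1
  | succ j ih =>
    rw [Function.iterate_succ_apply' _ (j + 1), Function.iterate_succ_apply' _ j]
    rw [Function.iterate_succ_apply' _ j] at ih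
    exact posSemidef_lyapunovStep_sub_riccatiStep hR
      (posSemidef_iterate_riccatiStep hQ hR.posSemidef j) ih _

/-- The states from which the origin can be reached in `j` steps of `x ↦ A x + B u`. -/
def nullControllable (A : Matrix (Fin n) (Fin n) ℝ) (B : Matrix (Fin n) (Fin m) ℝ) :
    ℕ → Set (Fin n → ℝ)
  | 0 => {0}
  | j + 1 => {x | ∃ u, A *ᵥ x + B *ᵥ u ∈ nullControllable A B j}

theorem mem_nullControllable (j : ℕ) (x : Fin n → ℝ) (u : ℕ → Fin m → ℝ)
    (h : A ^ j *ᵥ x + ∑ i ∈ Finset.range j, (A ^ i * B) *ᵥ u i = 0) :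
    x ∈ nullControllable A B j := by
  induction j generalizing x with
  | zero => simpa [nullControllable] using h
  | succ j ih =>
    refine ⟨u j, ih _ ?_⟩
    rw [Finset.sum_range_succ] at h
    rw [← h, mulVec_add, mulVec_mulVec, mulVec_mulVec, pow_succ]
    abel

theorem Controllable.mem_nullControllable (hAB : Controllable A B) (x : Fin n → ℝ) :
    x ∈ nullControllable A B n := by
  unfold Controllable at hAB
  set C : Matrix (Fin n) (Fin n × Fin m) ℝ := Matrix.of fun i p => (A ^ (p.1 : ℕ) * B) i p.2
    with hC
  have hsurj : Function.Surjective C.mulVecLin := by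
    rw [← LinearMap.range_eq_top]
    refine Submodule.eq_top_of_finrank_eq ?_
    rw [Module.finrank_fin_fun]
    exact hAB
  obtain ⟨w, hw⟩ := hsurj (-(A ^ n *ᵥ x))
  refine _root_.mem_nullControllable n x
    (fun i l => if h : i < n then w (⟨i, h⟩, l) else 0) ?_
  rw [Finset.sum_range, add_eq_zero_iff_neg_eq, ← hw]
  ext i
  simp [hC, Matrix.mulVec, dotProduct, Fintype.sum_prod_type]

theorem exists_mulVec_eq {x : Fin n → ℝ} (hx : x ≠ 0) (u : Fin m → ℝ) :
    ∃ K : Matrix (Fin m) (Fin n) ℝ, K *ᵥ x = u := by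
  refine ⟨(x ⬝ᵥ x)⁻¹ • vecMulVec u x, ?_⟩
  have : x ⬝ᵥ x ≠ 0 := by simpa using hx
  ext i
  simp [smul_mulVec, vecMulVec_mulVec, inv_mul_cancel_left₀ this]

theorem Matrix.PosSemidef.dotProduct_mulVec_le {ι : Type*} [Fintype ι] {Z W : Matrix ι ι ℝ}
    (h : (W - Z).PosSemidef) (x : ι → ℝ) : x ⬝ᵥ Z *ᵥ x ≤ x ⬝ᵥ W *ᵥ x := by
  have := h.dotProduct_mulVec_nonneg x
  rw [sub_mulVec, dotProduct_sub, star_trivial] at this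
  linarith

theorem iterate_riccatiStep_bounded (hQ : Q.PosSemidef) (hR : R.PosDef) (j : ℕ)
    (x : Fin n → ℝ) (hx : x ∈ nullControllable A B j) :
    ∃ c : ℝ, ∀ k, x ⬝ᵥ (riccatiStep A B Q R)^[k] 0 *ᵥ x ≤ c := by
  induction j generalizing x with
  | zero =>
    obtain rfl : x = 0 := hx
    exact ⟨0, by simp⟩
  | succ j ih =>
    obtain ⟨u, hu⟩ := hx
    obtain ⟨c, hc⟩ := ih _ hu
    rcases eq_or_ne x 0 with rfl | hx0
    · exact ⟨0, by simp⟩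
    obtain ⟨K, hK⟩ := exists_mulVec_eq hx0 (-u)
    refine ⟨max 0 (c + x ⬝ᵥ (Kᵀ * R * K + Q) *ᵥ x), fun k => ?_⟩
    cases k with
    | zero => simp
    | succ k =>
      rw [Function.iterate_succ_apply']
      have hP := posSemidef_iterate_riccatiStep (A := A) (B := B) hQ hR.posSemidef k
      have h0 := hc k
      generalize (riccatiStep A B Q R)^[k] 0 = P at hP h0 ⊢
      have hPP : (P - P).PosSemidef := by simpa using PosSemidef.zero
      refine ((posSemidef_lyapunovStep_sub_riccatiStep hR hP hPP K).dotProduct_mulVec_le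
        x).trans (le_max_of_le_right ?_)
      have hcl : (A - B * K) *ᵥ x = A *ᵥ x + B *ᵥ u := by
        rw [sub_mulVec, ← mulVec_mulVec, hK, mulVec_neg, sub_neg_eq_add]
      rw [lyapunovStep, add_assoc, add_mulVec, dotProduct_add, ← mulVec_mulVec, ← mulVec_mulVec,
        dotProduct_mulVec x (A - B * K)ᵀ, vecMul_transpose, hcl]
      linarith

/-- A Loewner-monotone, pointwise bounded sequence of symmetric matrices converges. -/
theorem exists_tendsto_of_posSemidef_succ_sub {ι : Type*} [Fintype ι] [DecidableEq ι]
    {Z : ℕ → Matrix ι ι ℝ} (hherm : ∀ j, (Z j).IsHermitian)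
    (hmono : ∀ j, (Z (j + 1) - Z j).PosSemidef)
    (hbdd : ∀ x : ι → ℝ, ∃ c : ℝ, ∀ j, x ⬝ᵥ Z j *ᵥ x ≤ c) :
    ∃ W, Tendsto Z atTop (𝓝 W) := by
  have hq : ∀ x : ι → ℝ, ∃ l : ℝ, Tendsto (fun j => x ⬝ᵥ Z j *ᵥ x) atTop (𝓝 l) := fun x => by
    obtain ⟨c, hc⟩ := hbdd x
    exact ⟨_, tendsto_atTop_ciSup (monotone_nat_of_le_succ fun j => (hmono j).dotProduct_mulVec_le x)
      ⟨c, by rintro _ ⟨j, rfl⟩; exact hc j⟩⟩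
  choose q hq using hq
  refine ⟨Matrix.of fun a b => (q (Pi.single a 1 + Pi.single b 1) - q (Pi.single a 1) -
    q (Pi.single b 1)) / 2, ?_⟩
  refine tendsto_pi_nhds.mpr fun a => tendsto_pi_nhds.mpr fun b => ?_
  refine ((((hq (Pi.single a 1 + Pi.single b 1)).sub (hq (Pi.single a 1))).sub
    (hq (Pi.single b 1))).div_const 2).congr fun j => ?_
  have hs : Z j b a = Z j a b := by simpa using (hherm j).apply a b
  simp only [mulVec_add, add_dotProduct, dotProduct_add, single_one_dotProduct, mulVec_single_one,
    Matrix.col_apply, hs]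
  ring

theorem continuousAt_riccatiStep (hR : R.PosDef) {P : Matrix (Fin n) (Fin n) ℝ}
    (hP : P.PosSemidef) : ContinuousAt (riccatiStep A B Q R) P := by
  have hdet : (R + Bᵀ * P * B).det ≠ 0 := (hR.add_transpose_mul_mul hP B).det_pos.ne'
  have hinv : ContinuousAt (fun V : Matrix (Fin n) (Fin n) ℝ => (R + Bᵀ * V * B)⁻¹) P := by
    refine ContinuousAt.comp (f := fun V : Matrix (Fin n) (Fin n) ℝ => R + Bᵀ * V * B)
      (g := Inv.inv) (continuousAt_matrix_inv _ ?_) ?_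
    · rw [Ring.inverse_eq_inv']
      exact continuousAt_inv₀ hdet
    · exact Continuous.continuousAt (by fun_prop)
  have hgain : ContinuousAt (riccatiGain A B R) P := by
    have hc : Continuous fun p : Matrix (Fin m) (Fin m) ℝ × Matrix (Fin n) (Fin n) ℝ =>
      p.1 * (Bᵀ * p.2 * A) := by fun_prop
    exact hc.continuousAt.comp (f := fun V : Matrix (Fin n) (Fin n) ℝ => ((R + Bᵀ * V * B)⁻¹, V))
      (hinv.prodMk continuousAt_id)
  have hc : Continuous fun p : Matrix (Fin m) (Fin n) ℝ × Matrix (Fin n) (Fin n) ℝ =>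
      lyapunovStep A B Q R p.1 p.2 := by
    unfold lyapunovStep
    fun_prop
  exact hc.continuousAt.comp (f := fun V => (riccatiGain A B R V, V))
    (hgain.prodMk continuousAt_id)

/-- Controllability yields a solution of the discrete algebraic Riccati equation. -/
theorem Controllable.exists_riccatiStep_eq (hAB : Controllable A B) (hQ : Q.PosSemidef)
    (hR : R.PosDef) : ∃ P : Matrix (Fin n) (Fin n) ℝ, P.PosSemidef ∧ riccatiStep A B Q R P = P := by
  have hpsd := posSemidef_iterate_riccatiStep (A := A) (B := B) hQ hR.posSemidef
  obtain ⟨P, hP⟩ := exists_tendsto_of_posSemidef_succ_sub (fun j => (hpsd j).1)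
    (posSemidef_iterate_riccatiStep_succ_sub (A := A) (B := B) hQ hR)
    (fun x => iterate_riccatiStep_bounded hQ hR n x (hAB.mem_nullControllable x))
  have hPpsd := PosSemidef.of_tendsto hpsd hP
  exact ⟨P, hPpsd, isFixedPt_of_tendsto_iterate hP (continuousAt_riccatiStep hR hPpsd)⟩

theorem isSchur_of_riccatiStep_eq (hQ : Q.PosDef) (hR : R.PosDef)
    {P : Matrix (Fin n) (Fin n) ℝ} (hP : P.PosSemidef) (h : riccatiStep A B Q R P = P) :
    IsSchur (A - B * riccatiGain A B R P) := by
  have hW : ((riccatiGain A B R P)ᵀ * R * riccatiGain A B R P + Q).PosDef :=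
    hQ.posSemidef_add (hR.posSemidef.transpose_mul_mul _)
  unfold riccatiStep lyapunovStep at h
  rw [add_assoc] at h
  generalize riccatiGain A B R P = L at *
  refine .of_lyapunov (P := P) ?_ ?_
  · rw [← h]
    exact hW.posSemidef_add (hP.transpose_mul_mul _)
  · rwa [sub_eq_of_eq_add' h.symm]

/-- A solution of the Riccati equation is a lower bound for the cost of every stabilizing gain. -/
theorem posSemidef_sub_of_riccatiStep_eq (hR : R.PosDef) {P X : Matrix (Fin n) (Fin n) ℝ}
    (hP : P.PosSemidef) (h : riccatiStep A B Q R P = P) {K : Matrix (Fin m) (Fin n) ℝ}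
    (hK : IsSchur (A - B * K)) (hX : lyapunovStep A B Q R K X = X) : (X - P).PosSemidef := by
  refine hK.posSemidef_of_lyapunov
    (W := (K - riccatiGain A B R P)ᵀ * (R + Bᵀ * P * B) * (K - riccatiGain A B R P))
    ((hR.add_transpose_mul_mul hP B).posSemidef.transpose_mul_mul _) ?_
  rw [← lyapunovStep_sub_riccatiStep (A := A) (Q := Q) hR hP, ← lyapunovStep_sub (Q := Q) (R := R),
    sub_add_sub_cancel, hX, h]

theorem eq_riccatiGain_of_riccatiStep_eq (hR : R.PosDef) {P : Matrix (Fin n) (Fin n) ℝ}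
    (hP : P.PosSemidef) (h : riccatiStep A B Q R P = P) {K : Matrix (Fin m) (Fin n) ℝ}
    (hK : lyapunovStep A B Q R K P = P) : K = riccatiGain A B R P := by
  have hG := hR.add_transpose_mul_mul hP B
  have hsq := lyapunovStep_sub_riccatiStep (A := A) (B := B) (Q := Q) hR hP K
  rw [hK, h, sub_self] at hsq
  rw [← sub_eq_zero]
  obtain ⟨C, hC, hCG⟩ := hG.exists_eq_mul_transpose
  rw [hCG] at hsq
  have hz : (Cᵀ * (K - riccatiGain A B R P))ᴴ * (Cᵀ * (K - riccatiGain A B R P)) = 0 := by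
    rw [hsq]
    simp [Matrix.mul_assoc]
  rw [Matrix.conjTranspose_mul_self_eq_zero] at hz
  have hdet : IsUnit Cᵀ.det :=
    (Matrix.isUnit_iff_isUnit_det _).mp ((Matrix.isUnit_transpose C).mpr hC)
  rw [← Matrix.nonsing_inv_mul_cancel_left _ (K - riccatiGain A B R P) hdet, hz, Matrix.mul_zero]

end Riccati

theorem stmt6 {n m : ℕ} (hn : 0 < n) (hm : 0 < m)
    (A : Matrix (Fin n) (Fin n) ℝ) (B : Matrix (Fin n) (Fin m) ℝ)
    (hAB : Controllable A B)
    (Q Sig : Matrix (Fin n) (Fin n) ℝ) (R : Matrix (Fin m) (Fin m) ℝ)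
    (hQ : Q.PosDef) (hR : R.PosDef) (hSig : Sig.PosDef)
    (X : Matrix (Fin m) (Fin n) ℝ → Matrix (Fin n) (Fin n) ℝ)
    (Y : Matrix (Fin m) (Fin n) ℝ → Matrix (Fin n) (Fin n) ℝ)
    (hX : ∀ K, IsSchur (A - B * K) →
      (A - B * K)ᵀ * X K * (A - B * K) + Kᵀ * R * K + Q = X K)
    (hY : ∀ K, IsSchur (A - B * K) →
      (A - B * K) * Y K * (A - B * K)ᵀ + Sig = Y K) :
    ∃ Kstar : Matrix (Fin m) (Fin n) ℝ,
      IsSchur (A - B * Kstar) ∧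
      -- `Kstar` is a global minimizer of `f` on `S`
      (∀ K, IsSchur (A - B * K) →
        Matrix.trace (X Kstar * Sig) ≤ Matrix.trace (X K * Sig)) ∧
      -- `Kstar` is the unique global minimizer
      (∀ K, IsSchur (A - B * K) →
        (∀ K', IsSchur (A - B * K') →
          Matrix.trace (X K * Sig) ≤ Matrix.trace (X K' * Sig)) → K = Kstar) ∧
      -- `Kstar` is the unique critical point of `f` in `S`
      (∀ K, IsSchur (A - B * K) →
        ((2 : ℝ) • ((R * K - Bᵀ * X K * (A - B * K)) * Y K) = 0 ↔ K = Kstar)) ∧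
      -- formula for `Kstar`
      Kstar = (R + Bᵀ * X Kstar * B)⁻¹ * (Bᵀ * X Kstar * A) := by
  obtain ⟨P, hP, hfix⟩ := hAB.exists_riccatiStep_eq hQ.posSemidef hR
  have hS := isSchur_of_riccatiStep_eq hQ hR hP hfix
  have hXP : X (riccatiGain A B R P) = P := by
    have h1 := hX _ hS
    have h2 : lyapunovStep A B Q R (riccatiGain A B R P) P = P := hfix
    unfold lyapunovStep at h2
    rw [add_assoc] at h1 h2
    exact hS.lyapunov_unique h1 h2
  have hle : ∀ K, IsSchur (A - B * K) → (X K - P).PosSemidef := fun K hK =>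
    posSemidef_sub_of_riccatiStep_eq hR hP hfix hK (hX K hK)
  have hXpsd : ∀ K, IsSchur (A - B * K) → (X K).PosSemidef := fun K hK => by
    simpa using (hle K hK).add hP
  have huniq : ∀ K, IsSchur (A - B * K) → X K = P → K = riccatiGain A B R P := fun K hK h =>
    eq_riccatiGain_of_riccatiStep_eq (A := A) (B := B) (Q := Q) hR hP hfix
      (h ▸ hX K hK)
  have hgrad : ∀ K, R * K - Bᵀ * X K * (A - B * K) =
      (R + Bᵀ * X K * B) * K - Bᵀ * X K * A := fun K => by
    simp only [Matrix.mul_sub, Matrix.add_mul, Matrix.mul_assoc]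
    abel
  refine ⟨riccatiGain A B R P, hS, fun K hK => ?_, fun K hK hmin => ?_,
    fun K hK => ⟨fun h => ?_, ?_⟩,
    by rw [hXP, riccatiGain]⟩
  · rw [hXP, ← sub_nonneg, ← trace_sub, ← Matrix.sub_mul]
    exact (hle K hK).trace_mul_nonneg hSig
  · refine huniq K hK (sub_eq_zero.mp ((hle K hK).eq_zero_of_trace_mul_eq_zero hSig ?_))
    refine le_antisymm ?_ ((hle K hK).trace_mul_nonneg hSig)
    have := hmin _ hS
    rw [hXP] at this
    rwa [Matrix.sub_mul, trace_sub, sub_nonpos]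
  · have hYunit : IsUnit (Y K) := by
      have hYpsd : (Y K).PosSemidef :=
        hK.transpose.posSemidef_of_lyapunov hSig.posSemidef (by simpa using hY K hK)
      have hYpd : (Y K).PosDef := by
        rw [← hY K hK]
        exact hSig.posSemidef_add (by simpa using hYpsd.transpose_mul_mul (A - B * K)ᵀ)
      exact hYpd.isUnit
    have h0 : (R + Bᵀ * X K * B) * K = Bᵀ * X K * A := by
      have h' := (smul_eq_zero.mp h).resolve_left two_ne_zero
      rw [hgrad] at h'
      rw [← sub_eq_zero, ← Matrix.mul_nonsing_inv_cancel_right (Y K) (_ - _)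
        ((Matrix.isUnit_iff_isUnit_det _).mp hYunit), h', Matrix.zero_mul]
    have hKgain : riccatiGain A B R (X K) = K := by
      rw [riccatiGain, ← h0, Matrix.nonsing_inv_mul_cancel_left]
      exact (Matrix.isUnit_iff_isUnit_det _).mp
        (hR.add_transpose_mul_mul (hXpsd K hK) B).isUnit
    have hfixK : riccatiStep A B Q R (X K) = X K := by
      rw [riccatiStep, hKgain]
      exact hX K hK
    exact huniq K hK (Matrix.PosSemidef.eq_of_sub_sub (hle K hK)
      (posSemidef_sub_of_riccatiStep_eq hR (hXpsd K hK) hfixK hS hfix))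
  · rintro rfl
    rw [hgrad, hXP, mul_riccatiGain hR hP, sub_self, Matrix.zero_mul, smul_zero]
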